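/- Let D ≥ 1 and let W, U be natural numbers with 1 ≤ W < U. For Q ∈ ℕ^D write Q_max = max_{1≤i≤D} Q_i. Let β ≥ 1, b₁ ≥ 1 be reals and let Φ̃ : ℕ^D → ℝ be nonnegative and satisfy: for every Q with Q_max ≤ U, Q_max^β ≤ Φ̃(Q) ≤ b₁ · Q_max^β. Define S^in = {Q ∈ ℕ^D : Q_max ≤ U and Φ̃(Q) ≤ (U−W)^β} and Φ'(Q) = (Φ̃(Q))^{1/β} for Q ∈ S^in, Φ'(Q) = U − W otherwise. Let κ be a Markov kernel on ℕ^D and let B̃ ≥ 1 and ε̃ with 0 < ε̃ ≤ B̃ be such that: (i) for every Q ∈ S^in, κ(Q)-almost every Q' satisfies |Q'_i − Q_i| ≤ W for every i; (ii) for every Q ∈ S^in with Q_max ≥ B̃, ∫ Φ̃(Q') κ(Q)(dQ') ≤ Φ̃(Q) − ε̃ · Q_max^{β−1}. Then for every Q ∈ S^in with Q_max ≥ B̃, ∫ Φ'(Q') κ(Q)(dQ') ≤ Φ'(Q) − b₁^{1/β − 1} · ε̃ / β. -/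

import Mathlib

open MeasureTheory ProbabilityTheory

/-- The maximum coordinate of a queue-backlog vector `Q ∈ ℕ^D`, as a real number. -/
noncomputable def queueMax {D : ℕ} (Q : Fin D → ℕ) : ℝ := ((Finset.univ.sup Q : ℕ) : ℝ)

/-- The linearized Lyapunov function: `Φ'(Q) = Φ̃(Q)^(1/β)` on
`S^in = {Q : Q_max ≤ U ∧ Φ̃(Q) ≤ (U−W)^β}`, and `Φ'(Q) = U − W` otherwise. -/
noncomputable def linPhi {D : ℕ} (W U : ℕ) (β : ℝ) (Φ : (Fin D → ℕ) → ℝ)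
    (Q : Fin D → ℕ) : ℝ :=
  if queueMax Q ≤ (U : ℝ) ∧ Φ Q ≤ ((U : ℝ) - (W : ℝ)) ^ β then (Φ Q) ^ (1 / β)
  else (U : ℝ) - (W : ℝ)

/-- The tangent-line inequality for the concave map `x ↦ x ^ p`, `0 ≤ p ≤ 1`. -/
lemma rpow_le_tangent {x a p : ℝ} (hx : 0 ≤ x) (ha : 0 < a) (hp0 : 0 ≤ p) (hp1 : p ≤ 1) :
    x ^ p ≤ a ^ p + p * a ^ (p - 1) * (x - a) := by
  have hxa : 0 ≤ x / a := div_nonneg hx ha.le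
  have h := rpow_one_add_le_one_add_mul_self (s := x / a - 1) (by linarith) hp0 hp1
  rw [add_sub_cancel, Real.div_rpow hx ha.le, div_le_iff₀ (Real.rpow_pos_of_pos ha p)] at h
  rw [Real.rpow_sub_one ha.ne']
  refine h.trans_eq ?_
  field_simp

lemma linPhi_nonneg {D : ℕ} {W U : ℕ} (hWU : W ≤ U) (β : ℝ) {Φ : (Fin D → ℕ) → ℝ}
    (hΦ0 : ∀ Q, 0 ≤ Φ Q) (Q : Fin D → ℕ) : 0 ≤ linPhi W U β Φ Q := by
  unfold linPhi
  split_ifs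
  · exact Real.rpow_nonneg (hΦ0 Q) _
  · exact sub_nonneg.2 (Nat.cast_le.2 hWU)

lemma linPhi_le_rpow {D : ℕ} {W U : ℕ} (hWU : W ≤ U) {β : ℝ} (hβ : 0 < β)
    (Φ : (Fin D → ℕ) → ℝ) {Q : Fin D → ℕ} (hQ : queueMax Q ≤ U) :
    linPhi W U β Φ Q ≤ Φ Q ^ (1 / β) := by
  have hUW : (0 : ℝ) ≤ U - W := sub_nonneg.2 (Nat.cast_le.2 hWU)
  unfold linPhi
  split_ifs with h
  · rfl
  · have hlt : ((U : ℝ) - W) ^ β < Φ Q := not_le.1 fun h' => h ⟨hQ, h'⟩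
    rw [one_div, Real.le_rpow_inv_iff_of_pos hUW ((Real.rpow_nonneg hUW β).trans hlt.le) hβ]
    exact hlt.le

lemma queueMax_nonneg {D : ℕ} (Q : Fin D → ℕ) : 0 ≤ queueMax Q := Nat.cast_nonneg _

lemma le_queueMax {D : ℕ} (Q : Fin D → ℕ) (i : Fin D) : (Q i : ℝ) ≤ queueMax Q :=
  Nat.cast_le.2 (Finset.le_sup (f := Q) (Finset.mem_univ i))

lemma queueMax_le_of_jump_le {D : ℕ} {W U : ℕ} {Q Q' : Fin D → ℕ}
    (hQ : queueMax Q ≤ (U : ℝ) - W) (h : ∀ i, |(Q' i : ℝ) - (Q i : ℝ)| ≤ (W : ℝ)) :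
    queueMax Q' ≤ U := by
  refine Nat.cast_le.2 (Finset.sup_le fun i _ => ?_)
  have h₁ := (abs_le.1 (h i)).2
  have h₂ := le_queueMax Q i
  exact_mod_cast (by linarith : (Q' i : ℝ) ≤ U)

/-- If `a ≤ b * M ^ β`, the slope of `x ↦ x ^ (1 / β)` at `a` compensates `M ^ (β - 1)`. -/
lemma rpow_le_rpow_mul_rpow_of_le {a b M β : ℝ} (ha : 0 < a) (hb : 0 < b) (hM : 0 < M)
    (hβ : 1 ≤ β) (hab : a ≤ b * M ^ β) :
    b ^ (1 / β - 1) ≤ a ^ (1 / β - 1) * M ^ (β - 1) := by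
  have hβ0 : 0 < β := one_pos.trans_le hβ
  have hexp : 1 / β - 1 ≤ 0 := sub_nonpos.2 ((div_le_one hβ0).2 hβ)
  calc b ^ (1 / β - 1) = (b * M ^ β) ^ (1 / β - 1) * M ^ (β - 1) := by
        rw [Real.mul_rpow hb.le (Real.rpow_nonneg hM.le β), ← Real.rpow_mul hM.le, mul_assoc,
          ← Real.rpow_add hM]
        have : β * (1 / β - 1) + (β - 1) = 0 := by field_simp; ring
        rw [this, Real.rpow_zero, mul_one]
    _ ≤ a ^ (1 / β - 1) * M ^ (β - 1) :=
        mul_le_mul_of_nonneg_right (Real.rpow_le_rpow_of_nonpos ha hab hexp)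
          (Real.rpow_nonneg hM.le _)

/-- Negative-drift property of the linearized Lyapunov function (Lemma 10, property 2):
if `Φ̃` satisfies the norm-equivalence bounds, the kernel `κ` has `W`-bounded jumps
from `S^in`, and `Φ̃` has drift `≤ −ε·Q_max^(β−1)` on `{Q ∈ S^in : Q_max ≥ B}`, then
on that set `Φ' = Φ̃^(1/β)` has drift `≤ −b₁^(1/β−1)·ε/β` under `κ`. -/
theorem stmt_3 {D : ℕ} (hD : 1 ≤ D) (W U : ℕ) (hW : 1 ≤ W) (hWU : W < U)
    (β b₁ : ℝ) (hβ : 1 ≤ β) (hb₁ : 1 ≤ b₁)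
    (Φ : (Fin D → ℕ) → ℝ) (hΦ0 : ∀ Q, 0 ≤ Φ Q)
    (H1 : ∀ Q : Fin D → ℕ, queueMax Q ≤ (U : ℝ) →
      (queueMax Q) ^ β ≤ Φ Q ∧ Φ Q ≤ b₁ * (queueMax Q) ^ β)
    (κ : Kernel (Fin D → ℕ) (Fin D → ℕ)) [IsMarkovKernel κ]
    (B ε : ℝ) (hB : 1 ≤ B) (hε : 0 < ε) (hεB : ε ≤ B)
    (hjump : ∀ Q : Fin D → ℕ, queueMax Q ≤ (U : ℝ) → Φ Q ≤ ((U : ℝ) - (W : ℝ)) ^ β →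
      ∀ᵐ Q' ∂(κ Q), ∀ i, |(Q' i : ℝ) - (Q i : ℝ)| ≤ (W : ℝ))
    (hdrift : ∀ Q : Fin D → ℕ, queueMax Q ≤ (U : ℝ) → Φ Q ≤ ((U : ℝ) - (W : ℝ)) ^ β →
      B ≤ queueMax Q →
      ∫ Q', Φ Q' ∂(κ Q) ≤ Φ Q - ε * (queueMax Q) ^ (β - 1)) :
    ∀ Q : Fin D → ℕ, queueMax Q ≤ (U : ℝ) → Φ Q ≤ ((U : ℝ) - (W : ℝ)) ^ β →
      B ≤ queueMax Q →
      ∫ Q', linPhi W U β Φ Q' ∂(κ Q) ≤ linPhi W U β Φ Q - b₁ ^ (1 / β - 1) * ε / β := by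
  intro Q hQU hΦQ hBQ
  have hβ0 : 0 < β := one_pos.trans_le hβ
  have hUW : (0 : ℝ) ≤ U - W := sub_nonneg.2 (Nat.cast_le.2 hWU.le)
  have hM : 0 < queueMax Q := by linarith
  have hΦpos : 0 < Φ Q := (Real.rpow_pos_of_pos hM β).trans_le (H1 Q hQU).1
  have hQUW : queueMax Q ≤ (U : ℝ) - W :=
    (Real.rpow_le_rpow_iff hM.le hUW hβ0).1 ((H1 Q hQU).1.trans hΦQ)
  have hmax : ∀ᵐ Q' ∂(κ Q), queueMax Q' ≤ (U : ℝ) := by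
    filter_upwards [hjump Q hQU hΦQ] with Q' h using queueMax_le_of_jump_le hQUW h
  have hint : Integrable Φ (κ Q) := by
    refine Integrable.of_bound (Measurable.of_discrete).aestronglyMeasurable
      (b₁ * (U : ℝ) ^ β) ?_
    filter_upwards [hmax] with Q' h
    rw [Real.norm_of_nonneg (hΦ0 Q')]
    refine (H1 Q' h).2.trans ?_
    gcongr
    exact queueMax_nonneg Q'
  set s : ℝ := 1 / β * Φ Q ^ (1 / β - 1) with hs
  have hs0 : 0 ≤ s := by positivity
  have hsub : Integrable (fun Q' => s * (Φ Q' - Φ Q)) (κ Q) :=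
    (hint.sub (integrable_const _)).const_mul s
  have htangent : Integrable (fun Q' => Φ Q ^ (1 / β) + s * (Φ Q' - Φ Q)) (κ Q) :=
    (integrable_const _).add hsub
  have hslope : b₁ ^ (1 / β - 1) ≤ Φ Q ^ (1 / β - 1) * queueMax Q ^ (β - 1) :=
    rpow_le_rpow_mul_rpow_of_le hΦpos (by linarith) hM hβ (H1 Q hQU).2
  calc ∫ Q', linPhi W U β Φ Q' ∂(κ Q)
      ≤ ∫ Q', (Φ Q ^ (1 / β) + s * (Φ Q' - Φ Q)) ∂(κ Q) := by
        refine integral_mono_of_nonneg (ae_of_all _ (linPhi_nonneg hWU.le β hΦ0)) htangent ?_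
        filter_upwards [hmax] with Q' h
        exact (linPhi_le_rpow hWU.le hβ0 Φ h).trans
          (rpow_le_tangent (hΦ0 Q') hΦpos (by positivity) ((div_le_one hβ0).2 hβ))
    _ = Φ Q ^ (1 / β) + s * (∫ Q', Φ Q' ∂(κ Q) - Φ Q) := by
        rw [integral_add (integrable_const _) hsub,
          integral_const_mul, integral_sub hint (integrable_const _)]
        simp
    _ ≤ Φ Q ^ (1 / β) + s * (-(ε * queueMax Q ^ (β - 1))) := by
        gcongr
        linarith [hdrift Q hQU hΦQ hBQ]
    _ = Φ Q ^ (1 / β) - Φ Q ^ (1 / β - 1) * queueMax Q ^ (β - 1) * ε / β := by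
        rw [hs]
        ring
    _ ≤ Φ Q ^ (1 / β) - b₁ ^ (1 / β - 1) * ε / β := by gcongr
    _ = linPhi W U β Φ Q - b₁ ^ (1 / β - 1) * ε / β := by
        rw [linPhi, if_pos ⟨hQU, hΦQ⟩]
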